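/- Let ν ≥ 0, let u, u′ : ℝ×ℝ³ → ℝ³, p, ζ : ℝ×ℝ³ → ℝ and f : ℝ×ℝ³ → ℝ³ be smooth and periodic in space, and let τ : ℝ×ℝ³ → ℝ be smooth, periodic in space and strictly positive. Assume that for every time t: (i) div u(t,·) = 0 pointwise; (ii) ∫_T ∇ζ·u′ dx = 0 and ∫_T ∇p·u′ dx = 0; (iii) the dynamic small-scale equation ∂ₜu′ + τ⁻¹u′ + ∇ζ + r = 0 holds pointwise on ℝ³, where r := ∂ₜu + ((u+u′)·∇)u + ∇p − νΔu − f; (iv) the GLSDD large-scale equation tested with (w,q,θ) = (u,p,ζ) holds, i.e. ∫_T [ u·∂ₜu + u·∂ₜu′ − (((u+u′)·∇)u)·u′ + 2ν ∇ˢu:∇u + ν Δu·u′ + ∇ζ·u′ ] dx = ∫_T u·f dx. Then the total kinetic energy E(t) := ½∫_T |u+u′|² dx satisfies, for every t, dE/dt = −ν∫_T |∇u|² dx − ∫_T τ⁻¹|u′|² dx + ∫_T (u+u′)·f dx. -/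

import Mathlib

open MeasureTheory Real

noncomputable section

/-- The periodicity cube `[0, 2π]³ ⊂ ℝ³`. -/
def Tcube : Set (Fin 3 → ℝ) := Set.Icc 0 (fun _ => 2 * Real.pi)

/-- Partial derivative of a scalar field on `ℝ³` in coordinate direction `j`. -/
def pd (f : (Fin 3 → ℝ) → ℝ) (j : Fin 3) (x : Fin 3 → ℝ) : ℝ :=
  fderiv ℝ f x (Pi.single j 1)

/-- `2π`-periodicity in each of the three coordinates. -/
def SpacePeriodic {α : Type*} (f : (Fin 3 → ℝ) → α) : Prop :=
  ∀ (x : Fin 3 → ℝ) (j : Fin 3), f (x + Pi.single j (2 * Real.pi)) = f x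

/-- Time derivative `∂ₜuᵢ` of the `i`-th component of a time-dependent vector field. -/
def dt (u : ℝ × (Fin 3 → ℝ) → (Fin 3 → ℝ)) (i : Fin 3) (t : ℝ) (x : Fin 3 → ℝ) : ℝ :=
  deriv (fun s => u (s, x) i) t

/-- Spatial partial derivative `∂ⱼuᵢ` of a time-dependent vector field. -/
def dx (u : ℝ × (Fin 3 → ℝ) → (Fin 3 → ℝ)) (i j : Fin 3) (t : ℝ) (x : Fin 3 → ℝ) : ℝ :=
  pd (fun y => u (t, y) i) j x

/-- Spatial partial derivative `∂ⱼp` of a time-dependent scalar field. -/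
def dxS (p : ℝ × (Fin 3 → ℝ) → ℝ) (j : Fin 3) (t : ℝ) (x : Fin 3 → ℝ) : ℝ :=
  pd (fun y => p (t, y)) j x

/-- Componentwise Laplacian `Δuᵢ` of a time-dependent vector field. -/
def lap (u : ℝ × (Fin 3 → ℝ) → (Fin 3 → ℝ)) (i : Fin 3) (t : ℝ) (x : Fin 3 → ℝ) : ℝ :=
  ∑ j, pd (fun y => dx u i j t y) j x

lemma contDiff_pd {f : (Fin 3 → ℝ) → ℝ} (hf : ContDiff ℝ (⊤ : ℕ∞) f) (j : Fin 3) :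
    ContDiff ℝ (⊤ : ℕ∞) (pd f j) :=
  (hf.fderiv_right (by simp)).clm_apply contDiff_const

lemma SpacePeriodic.pd {f : (Fin 3 → ℝ) → ℝ} (hf : SpacePeriodic f) (j : Fin 3) :
    SpacePeriodic (pd f j) := by
  intro x k
  have h : (fun y => f (y + Pi.single k (2 * Real.pi))) = f := funext fun y => hf y k
  unfold _root_.pd
  conv_rhs => rw [← h]
  rw [fderiv_comp_add_right]

lemma pd_comm {f : (Fin 3 → ℝ) → ℝ} (hf : ContDiff ℝ (⊤ : ℕ∞) f) (i j : Fin 3)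
    (x : Fin 3 → ℝ) : pd (pd f i) j x = pd (pd f j) i x := by
  have hd : DifferentiableAt ℝ (fderiv ℝ f) x :=
    ((hf.fderiv_right (m := (⊤ : ℕ∞)) (by simp)).differentiable (by simp)) x
  have key (k l : Fin 3) : pd (pd f k) l x
      = fderiv ℝ (fderiv ℝ f) x (Pi.single l 1) (Pi.single k 1) := by
    unfold pd
    rw [fderiv_clm_apply hd (differentiableAt_const _)]
    simp
  rw [key, key]
  exact hf.contDiffAt.isSymmSndFDerivAt
    (by simp only [minSmoothness_of_isRCLikeNormedField]; exact WithTop.coe_le_coe.2 le_top) _ _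

lemma pd_mul {f g : (Fin 3 → ℝ) → ℝ} (hf : Differentiable ℝ f) (hg : Differentiable ℝ g)
    (j : Fin 3) (x : Fin 3 → ℝ) :
    pd (fun y => f y * g y) j x = pd f j x * g x + f x * pd g j x := by
  unfold pd
  rw [fderiv_fun_mul (hf x) (hg x)]
  simp
  ring

lemma pd_sum {f : Fin 3 → (Fin 3 → ℝ) → ℝ} (hf : ∀ i, Differentiable ℝ (f i))
    (j : Fin 3) (x : Fin 3 → ℝ) :
    pd (fun y => ∑ i, f i y) j x = ∑ i, pd (f i) j x := by
  unfold pd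
  rw [fderiv_fun_sum fun i _ => hf i x]
  simp

lemma Continuous.integrableOn_Tcube {f : (Fin 3 → ℝ) → ℝ} (hf : Continuous f) :
    Integrable f (volume.restrict Tcube) :=
  hf.continuousOn.integrableOn_compact isCompact_Icc

/-- The integral of the divergence of a periodic vector field over a period cell vanishes. -/
lemma integral_sum_pd_eq_zero {g : Fin 3 → (Fin 3 → ℝ) → ℝ}
    (hg : ∀ j, ContDiff ℝ (⊤ : ℕ∞) (g j)) (hper : ∀ j, SpacePeriodic (g j)) :
    ∫ x in Tcube, ∑ j, pd (g j) j x = 0 := by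
  have hle : (0 : Fin 3 → ℝ) ≤ fun _ => 2 * Real.pi := fun _ => by
    simpa using Real.pi_pos.le
  have h := integral_divergence_of_hasFDerivAt_off_countable' (n := 2) (0 : Fin 3 → ℝ)
    (fun _ => 2 * Real.pi) hle g (fun j => fderiv ℝ (g j)) ∅ Set.countable_empty
    (fun j => (hg j).continuous.continuousOn)
    (fun x _ j => ((hg j).differentiable (by simp) x).hasFDerivAt)
    (Continuous.integrableOn_Tcube
      (continuous_finsetSum _ fun j _ => (contDiff_pd (hg j) j).continuous))
  refine h.trans (Finset.sum_eq_zero fun j _ => sub_eq_zero.2 ?_)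
  congr 1
  funext x
  rw [← hper j (j.insertNth ((0 : Fin 3 → ℝ) j) x) j]
  congr 1
  ext k
  refine Fin.succAboveCases j ?_ (fun l => ?_) k <;> simp

/-- A divergence-free periodic field satisfies `∫ ∇v : (∇v)ᵀ = 0`. -/
lemma integral_grad_mul_grad_transpose_eq_zero {v : Fin 3 → (Fin 3 → ℝ) → ℝ}
    (hv : ∀ i, ContDiff ℝ (⊤ : ℕ∞) (v i)) (hper : ∀ i, SpacePeriodic (v i))
    (hdiv : ∀ x, ∑ i, pd (v i) i x = 0) :
    ∫ x in Tcube, ∑ i, ∑ j, pd (v i) j x * pd (v j) i x = 0 := by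
  have hd (i j) : Differentiable ℝ (pd (v i) j) :=
    (contDiff_pd (hv i) j).differentiable (by simp)
  have hdiv' (i : Fin 3) (x) : ∑ j, pd (pd (v j) i) j x = 0 := by
    have h0 : (fun y => ∑ j, pd (v j) j y) = fun _ => 0 := funext hdiv
    simp_rw [fun j => pd_comm (hv j) i j x]
    rw [← pd_sum (fun j => hd j j), h0]
    simp [pd]
  have h := integral_sum_pd_eq_zero (g := fun j x => ∑ i, v i x * pd (v j) i x)
    (fun j => ContDiff.sum fun i _ => (hv i).mul (contDiff_pd (hv j) i))
    (fun j x k => by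
      simp only [fun i => hper i x k, fun i => (hper j).pd i x k])
  rw [← h]
  congr 1
  funext x
  have hvd (i) : Differentiable ℝ (v i) := (hv i).differentiable (by simp)
  simp_rw [fun j => pd_sum (f := fun i x => v i x * pd (v j) i x)
      (fun i => (hvd i).mul (hd j i)) j x, fun i j => pd_mul (hvd i) (hd j i) j x,
    Finset.sum_add_distrib]
  rw [Finset.sum_comm (f := fun j i => v i x * pd (pd (v j) i) j x)]
  simp_rw [← Finset.mul_sum, hdiv', mul_zero, Finset.sum_const_zero, add_zero]
  exact Finset.sum_comm

lemma hasDerivAt_time {F : ℝ × (Fin 3 → ℝ) → ℝ} (hF : ContDiff ℝ (⊤ : ℕ∞) F) (t : ℝ)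
    (x : Fin 3 → ℝ) : HasDerivAt (fun s => F (s, x)) (fderiv ℝ F (t, x) (1, 0)) t :=
  ((hF.differentiable (by simp) (t, x)).hasFDerivAt).comp_hasDerivAt t
    ((hasDerivAt_id t).prodMk (hasDerivAt_const t x))

lemma continuous_fderiv_time {F : ℝ × (Fin 3 → ℝ) → ℝ} (hF : ContDiff ℝ (⊤ : ℕ∞) F) :
    Continuous fun z => fderiv ℝ F z (1, 0) :=
  (hF.continuous_fderiv (by simp)).clm_apply continuous_const

lemma hasDerivAt_integral_Tcube {F : ℝ × (Fin 3 → ℝ) → ℝ} (hF : ContDiff ℝ (⊤ : ℕ∞) F)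
    (t : ℝ) : HasDerivAt (fun s => ∫ x in Tcube, F (s, x))
      (∫ x in Tcube, fderiv ℝ F (t, x) (1, 0)) t := by
  have hT : IsCompact Tcube := isCompact_Icc
  obtain ⟨C, hC⟩ := ((isCompact_Icc (a := t - 1) (b := t + 1)).prod hT).exists_bound_of_continuousOn
    (continuous_fderiv_time hF).continuousOn
  have hc (s : ℝ) : Continuous fun x => F (s, x) := hF.continuous.comp (by fun_prop)
  refine (hasDerivAt_integral_of_dominated_loc_of_deriv_le (bound := fun _ => C)
    (F' := fun s x => fderiv ℝ F (s, x) (1, 0))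
    (Icc_mem_nhds (a := t - 1) (b := t + 1) (by linarith) (by linarith))
    (.of_forall fun s => (hc s).aestronglyMeasurable) (hc t).integrableOn_Tcube
    ((continuous_fderiv_time hF).comp (by fun_prop : Continuous fun x => (t, x))).aestronglyMeasurable
    ?_ continuous_const.integrableOn_Tcube
    (.of_forall fun x s _ => hasDerivAt_time hF s x)).2
  exact (ae_restrict_iff' measurableSet_Icc).2 (.of_forall fun x hx s hs => hC (s, x) ⟨hs, hx⟩)

lemma continuous_dt {u : ℝ × (Fin 3 → ℝ) → (Fin 3 → ℝ)} (hu : ContDiff ℝ (⊤ : ℕ∞) u)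
    (i : Fin 3) (t : ℝ) : Continuous (dt u i t) := by
  have hui : ContDiff ℝ (⊤ : ℕ∞) fun z => u z i := contDiff_pi.1 hu i
  have h : dt u i t = fun x => fderiv ℝ (fun z => u z i) (t, x) (1, 0) :=
    funext fun x => (hasDerivAt_time hui t x).deriv
  rw [h]
  exact (continuous_fderiv_time hui).comp (by fun_prop : Continuous fun x => (t, x))


/-- Correct-energy evolution of the GLSDD formulation (Galerkin/least-squares with
dynamic divergence-free small-scales): the total kinetic energy of `u + u′` satisfies
`dE/dt = -ν‖∇u‖² - ‖τ^{-1/2}u′‖² + (u+u′, f)`. -/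
theorem glsdd_total_energy_evolution
    (ν : ℝ) (hν : 0 ≤ ν)
    (u u' f : ℝ × (Fin 3 → ℝ) → (Fin 3 → ℝ))
    (p ζ τ : ℝ × (Fin 3 → ℝ) → ℝ)
    (hu : ContDiff ℝ (⊤ : ℕ∞) u) (hu' : ContDiff ℝ (⊤ : ℕ∞) u')
    (hf : ContDiff ℝ (⊤ : ℕ∞) f) (hp : ContDiff ℝ (⊤ : ℕ∞) p)
    (hζ : ContDiff ℝ (⊤ : ℕ∞) ζ) (hτ : ContDiff ℝ (⊤ : ℕ∞) τ)
    (hup : ∀ t, SpacePeriodic fun x => u (t, x))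
    (hu'p : ∀ t, SpacePeriodic fun x => u' (t, x))
    (hfp : ∀ t, SpacePeriodic fun x => f (t, x))
    (hpp : ∀ t, SpacePeriodic fun x => p (t, x))
    (hζp : ∀ t, SpacePeriodic fun x => ζ (t, x))
    (hτp : ∀ t, SpacePeriodic fun x => τ (t, x))
    (hτpos : ∀ t x, 0 < τ (t, x))
    -- (i) the large-scale velocity is pointwise divergence free
    (hdiv : ∀ t x, (∑ i, dx u i i t x) = 0)
    -- (ii) orthogonality of the small-scales to the discrete pressure gradients
    (horthζ : ∀ t, (∫ x in Tcube, ∑ i, dxS ζ i t x * u' (t, x) i) = 0)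
    (horthp : ∀ t, (∫ x in Tcube, ∑ i, dxS p i t x * u' (t, x) i) = 0)
    -- (iii) the dynamic small-scale equation ∂ₜu′ + τ⁻¹u′ + ∇ζ + r = 0
    (hsmall : ∀ t x i,
      dt u' i t x + (τ (t, x))⁻¹ * u' (t, x) i + dxS ζ i t x
        + (dt u i t x + (∑ j, (u (t, x) j + u' (t, x) j) * dx u i j t x)
            + dxS p i t x - ν * lap u i t x - f (t, x) i) = 0)
    -- (iv) the GLSDD large-scale equation tested with (w, q, θ) = (u, p, ζ)
    (hlarge : ∀ t,
      (∫ x in Tcube,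
        ((∑ i, u (t, x) i * dt u i t x)
          + (∑ i, u (t, x) i * dt u' i t x)
          - (∑ i, (∑ j, (u (t, x) j + u' (t, x) j) * dx u i j t x) * u' (t, x) i)
          + 2 * ν * (∑ i, ∑ j, ((1/2) * (dx u i j t x + dx u j i t x)) * dx u i j t x)
          + ν * (∑ i, lap u i t x * u' (t, x) i)
          + (∑ i, dxS ζ i t x * u' (t, x) i)))
      = ∫ x in Tcube, ∑ i, u (t, x) i * f (t, x) i) :
    ∀ t, HasDerivAt
      (fun s => (1/2) * ∫ x in Tcube, ∑ i, (u (s, x) i + u' (s, x) i)^2)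
      (- (ν * ∫ x in Tcube, ∑ i, ∑ j, (dx u i j t x)^2)
        - (∫ x in Tcube, (τ (t, x))⁻¹ * ∑ i, (u' (t, x) i)^2)
        + ∫ x in Tcube, ∑ i, (u (t, x) i + u' (t, x) i) * f (t, x) i) t := by
  intro t
  have slice {E : Type} [NormedAddCommGroup E] [NormedSpace ℝ E] {g : ℝ × (Fin 3 → ℝ) → E}
      (hg : ContDiff ℝ (⊤ : ℕ∞) g) : ContDiff ℝ (⊤ : ℕ∞) fun x => g (t, x) :=
    hg.comp (contDiff_const.prodMk contDiff_id)
  have hus (i) : ContDiff ℝ (⊤ : ℕ∞) fun x => u (t, x) i := contDiff_pi.1 (slice hu) i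
  have hdxs (i j) : ContDiff ℝ (⊤ : ℕ∞) fun x => dx u i j t x := contDiff_pd (hus i) j
  have cu (i) : Continuous fun x => u (t, x) i := (hus i).continuous
  have cu' (i) : Continuous fun x => u' (t, x) i := (contDiff_pi.1 (slice hu') i).continuous
  have cf (i) : Continuous fun x => f (t, x) i := (contDiff_pi.1 (slice hf) i).continuous
  have cdtu (i) : Continuous fun x => dt u i t x := continuous_dt hu i t
  have cdtu' (i) : Continuous fun x => dt u' i t x := continuous_dt hu' i t
  have cdx (i j) : Continuous fun x => dx u i j t x := (hdxs i j).continuous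
  have cζ (i) : Continuous fun x => dxS ζ i t x := (contDiff_pd (slice hζ) i).continuous
  have cp (i) : Continuous fun x => dxS p i t x := (contDiff_pd (slice hp) i).continuous
  have cτ : Continuous fun x => (τ (t, x))⁻¹ :=
    (slice hτ).continuous.inv₀ fun x => (hτpos t x).ne'
  have hS : ∫ x in Tcube, ∑ i, ∑ j, dx u i j t x * dx u j i t x = 0 :=
    integral_grad_mul_grad_transpose_eq_zero hus
      (fun i x k => congrFun (hup t x k) i) (hdiv t)
  have hE := (hasDerivAt_integral_Tcube
    (F := fun z => ∑ i, (u z i + u' z i) ^ 2)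
    (ContDiff.sum fun i _ => ((contDiff_pi.1 hu i).add (contDiff_pi.1 hu' i)).pow 2) t).const_mul
    (1 / 2 : ℝ)
  have hD (x) : fderiv ℝ (fun z => ∑ i, (u z i + u' z i) ^ 2) (t, x) (1, 0)
      = 2 * ∑ i, (u (t, x) i + u' (t, x) i) * (dt u i t x + dt u' i t x) := by
    have h1 := hasDerivAt_time (F := fun z => ∑ i, (u z i + u' z i) ^ 2)
      (ContDiff.sum fun i _ => ((contDiff_pi.1 hu i).add (contDiff_pi.1 hu' i)).pow 2) t x
    have h2 (i) : HasDerivAt (fun s => u (s, x) i) (dt u i t x) t :=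
      (hasDerivAt_time (contDiff_pi.1 hu i) t x).differentiableAt.hasDerivAt
    have h3 (i) : HasDerivAt (fun s => u' (s, x) i) (dt u' i t x) t :=
      (hasDerivAt_time (contDiff_pi.1 hu' i) t x).differentiableAt.hasDerivAt
    rw [h1.unique (HasDerivAt.fun_sum fun i _ => ((h2 i).add (h3 i)).pow 2), Finset.mul_sum]
    refine Finset.sum_congr rfl fun i _ => ?_
    simp
    ring
  simp_rw [hD, integral_const_mul] at hE
  refine hE.congr_deriv ?_
  have iD : Integrable (fun x => ∑ i, (u (t, x) i + u' (t, x) i) * (dt u i t x + dt u' i t x))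
      (volume.restrict Tcube) :=
    Continuous.integrableOn_Tcube (continuous_finsetSum _ fun i _ => ((cu i).add (cu' i)).mul ((cdtu i).add (cdtu' i)))
  have iG : Integrable (fun x => ∑ i, ∑ j, (dx u i j t x) ^ 2)
      (volume.restrict Tcube) :=
    Continuous.integrableOn_Tcube (by fun_prop)
  have iS : Integrable (fun x => ∑ i, ∑ j, dx u i j t x * dx u j i t x)
      (volume.restrict Tcube) :=
    Continuous.integrableOn_Tcube (by fun_prop)
  have iT : Integrable (fun x => (τ (t, x))⁻¹ * ∑ i, (u' (t, x) i) ^ 2)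
      (volume.restrict Tcube) :=
    Continuous.integrableOn_Tcube (cτ.mul (continuous_finsetSum _ fun i _ => (cu' i).pow 2))
  have iF : Integrable (fun x => ∑ i, (u (t, x) i + u' (t, x) i) * f (t, x) i)
      (volume.restrict Tcube) :=
    Continuous.integrableOn_Tcube (continuous_finsetSum _ fun i _ => ((cu i).add (cu' i)).mul (cf i))
  have iZ : Integrable (fun x => ∑ i, dxS ζ i t x * u' (t, x) i)
      (volume.restrict Tcube) :=
    Continuous.integrableOn_Tcube (continuous_finsetSum _ fun i _ => (cζ i).mul (cu' i))
  have iP : Integrable (fun x => ∑ i, dxS p i t x * u' (t, x) i)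
      (volume.restrict Tcube) :=
    Continuous.integrableOn_Tcube (continuous_finsetSum _ fun i _ => (cp i).mul (cu' i))
  have iU : Integrable (fun x => ∑ i, u (t, x) i * f (t, x) i)
      (volume.restrict Tcube) :=
    Continuous.integrableOn_Tcube (continuous_finsetSum _ fun i _ => (cu i).mul (cf i))
  have iDG := iD.fun_add (iG.const_mul ν)
  have iDGS := iDG.fun_add (iS.const_mul ν)
  have iDGST := iDGS.fun_add iT
  have iDGSTZ := iDGST.fun_add (iZ.const_mul 2)
  have iDGSTZP := iDGSTZ.fun_add iP
  have key := hlarge t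
  rw [integral_congr_ae (g := fun x =>
      (∑ i, (u (t, x) i + u' (t, x) i) * (dt u i t x + dt u' i t x))
      + ν * (∑ i, ∑ j, (dx u i j t x) ^ 2)
      + ν * (∑ i, ∑ j, dx u i j t x * dx u j i t x)
      + (τ (t, x))⁻¹ * (∑ i, (u' (t, x) i) ^ 2)
      + 2 * (∑ i, dxS ζ i t x * u' (t, x) i)
      + (∑ i, dxS p i t x * u' (t, x) i)
      + (∑ i, u (t, x) i * f (t, x) i)
      - (∑ i, (u (t, x) i + u' (t, x) i) * f (t, x) i)) (.of_forall fun x => ?_),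
    integral_sub (iDGSTZP.fun_add iU) iF, integral_add iDGSTZP iU, integral_add iDGSTZ iP,
    integral_add iDGST (iZ.const_mul 2), integral_add iDGS iT, integral_add iDG (iS.const_mul ν),
    integral_add iD (iG.const_mul ν)] at key
  · simp only [integral_const_mul] at key
    rw [hS, horthζ t, horthp t] at key
    linarith
  · have h0 := hsmall t x 0
    have h1 := hsmall t x 1
    have h2 := hsmall t x 2
    simp only [Fin.sum_univ_three] at h0 h1 h2 ⊢
    linear_combination (-u' (t, x) 0) * h0 - u' (t, x) 1 * h1 - u' (t, x) 2 * h2
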